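/- Let (R, m) be a noetherian local ring and a ⊊ R a proper ideal. Then dim R/a ≥ depth R − depth(a, R), where depth(a, R) denotes the maximal length of an R-regular sequence contained in a. -/

import Mathlib

/-!
Auxiliary definitions: integer-valued topological (Krull) dimension, connectivity
dimension, subdimension, local cohomological dimension and depth.
-/

open TopologicalSpace

/-- The (topological Krull) dimension of a topological space, as an integer:
the supremum of the lengths of strictly increasing chains of irreducible closed subsets,
with the convention that the empty space has dimension `-1`. -/
noncomputable def topDim (T : Type*) [TopologicalSpace T] : ℤ :=
  sSup ({-1} ∪ {d : ℤ | ∃ n : ℕ, d = (n : ℤ) ∧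
    ∃ c : Fin (n + 1) → IrreducibleCloseds T, StrictMono c})

/-- The connectivity dimension `c(T)` of a topological space `T`: the minimum of `topDim Z`
over the closed subsets `Z ⊆ T` such that `T \ Z` is disconnected, the empty space counting
as disconnected (of dimension `-1`). -/
noncomputable def connDim (T : Type*) [TopologicalSpace T] : ℤ :=
  sInf {d : ℤ | ∃ Z : Set T, IsClosed Z ∧ ¬ ConnectedSpace ↥(Zᶜ) ∧ d = topDim ↥Z}

/-- The subdimension `sdim T` of a topological space: the minimum of the dimensions of its
irreducible components. -/
noncomputable def subDim (T : Type*) [TopologicalSpace T] : ℤ :=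
  sInf {d : ℤ | ∃ C ∈ irreducibleComponents T, d = topDim ↥C}

/-- The connectivity dimension `c(R)` of a commutative ring `R`, i.e. that of `Spec R`. -/
noncomputable def ringConnDim (R : Type) [CommRing R] : ℤ :=
  connDim (PrimeSpectrum R)

/-- The cohomological dimension `cd(M, a) = sup { i ∈ ℕ | H^i_a(M) ≠ 0 }` of an ideal `a`
with respect to a module `M`, where `H^i_a` is local cohomology with support in `a`. -/
noncomputable def cohDim (R : Type) [CommRing R] (a : Ideal R)
    (M : Type) [AddCommGroup M] [Module R M] : ℤ :=
  sSup {d : ℤ | ∃ i : ℕ, d = (i : ℤ) ∧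
    Nontrivial ((localCohomology a i).obj (ModuleCat.of R M))}

/-- `depth(a, M)`: the supremum of the lengths of `M`-regular sequences contained in the
ideal `a`. -/
noncomputable def idealDepth (R : Type) [CommRing R] (a : Ideal R)
    (M : Type) [AddCommGroup M] [Module R M] : ℤ :=
  sSup {d : ℤ | ∃ rs : List R, d = (rs.length : ℤ) ∧ (∀ r ∈ rs, r ∈ a) ∧
    RingTheory.Sequence.IsRegular M rs}

open RingTheory.Sequence CategoryTheory Abelian in
theorem aux_depth_quot (R : Type) [CommRing R] [IsNoetherianRing R] [IsLocalRing R]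
    (M : Type) [AddCommGroup M] [Module R M] [Module.Finite R M] [Nontrivial M]
    (y : R) (hy : y ∈ IsLocalRing.maximalIdeal R) (hreg : IsSMulRegular M y) (n : ℕ)
    (h : ∃ rs : List R, rs.length = n + 1 ∧ (∀ r ∈ rs, r ∈ IsLocalRing.maximalIdeal R) ∧
      IsRegular M rs) :
    ∃ rs : List R, rs.length = n ∧ (∀ r ∈ rs, r ∈ IsLocalRing.maximalIdeal R) ∧
      IsRegular (QuotSMulTop y M) rs := by
  have key : ∀ (L : Type) [AddCommGroup L] [Module R L] [Module.Finite R L] [Nontrivial L],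
      IsLocalRing.maximalIdeal R • (⊤ : Submodule R L) < ⊤ := by
    intro L _ _ _ _
    exact lt_top_iff_ne_top.mpr
      (Submodule.top_ne_ideal_smul_of_le_jacobson_annihilator
        (IsLocalRing.maximalIdeal_le_jacobson _)).symm
  have : Nontrivial (QuotSMulTop y M) := nontrivial_quotSMulTop_of_mem_maximalIdeal M hy
  have h1 := ((ModuleCat.exists_isRegular_tfae.{0} (IsLocalRing.maximalIdeal R) (n+1)
    (ModuleCat.of R M) (key M)).out 3 1).mp h
  refine ((ModuleCat.exists_isRegular_tfae.{0} (IsLocalRing.maximalIdeal R) n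
    (ModuleCat.of R (QuotSMulTop y M)) (key _)).out 1 3).mp ?_
  intro i hi
  have zero1 := AddCommGrpCat.isZero_of_iff_subsingleton.mpr (h1 i (by omega))
  have zero2 := AddCommGrpCat.isZero_of_iff_subsingleton.mpr (h1 (i + 1) (by omega))
  have hreg' : IsSMulRegular (ModuleCat.of R M) y := hreg
  exact AddCommGrpCat.subsingleton_of_isZero <| ShortComplex.Exact.isZero_of_both_zeros
    ((Ext.covariant_sequence_exact₃' _ hreg'.smulShortComplex_shortExact) i (i + 1) rfl)
    (zero1.eq_zero_of_src _) (zero2.eq_zero_of_tgt _)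

open RingTheory.Sequence Pointwise in
theorem aux_chain (R : Type) [CommRing R] [IsNoetherianRing R] [IsLocalRing R]
    (rs : List R) : ∀ (M : Type) [AddCommGroup M] [Module R M] [Module.Finite R M]
    (_ : ∀ r ∈ rs, r ∈ IsLocalRing.maximalIdeal R) (_ : IsRegular M rs)
    (p : Ideal R) (hp : IsAssociatedPrime p M),
    ∃ c : LTSeries (PrimeSpectrum R), c.length = rs.length ∧ c.head = ⟨p, hp.isPrime⟩ := by
  induction rs with
  | nil =>
    intro M _ _ _ _ _ p hp
    exact ⟨RelSeries.singleton _ ⟨p, hp.isPrime⟩, rfl, rfl⟩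
  | cons x rs ih =>
    intro M _ _ _ hm hr p hp
    rw [isRegular_cons_iff] at hr
    obtain ⟨hx, hr⟩ := hr
    simp only [List.mem_cons, forall_eq_or_imp] at hm
    obtain ⟨hpp, z, hz⟩ := Submodule.isAssociatedPrime_iff.mp hp
    have hann : ∀ r, r ∈ p ↔ r • z = 0 := by
      intro r
      rw [hz, Submodule.mem_colon_singleton, Submodule.mem_bot]
    have hz0 : z ≠ 0 := by
      rintro rfl
      exact hpp.ne_top ((Ideal.eq_top_iff_one p).mpr ((hann 1).mpr (smul_zero _)))
    have hxp : x ∉ p := fun h => hz0 (hx (by simpa using (hann x).mp h))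
    let N : Submodule R M :=
      { carrier := {m | ∀ r ∈ p, r • m = 0}
        zero_mem' := fun r _ => smul_zero r
        add_mem' := fun {a b} ha hb r h => by rw [smul_add, ha r h, hb r h, add_zero]
        smul_mem' := fun c m hm r h => by rw [smul_comm, hm r h, smul_zero] }
    obtain ⟨w, hwN, hw⟩ : ∃ w ∈ N, w ∉ x • (⊤ : Submodule R M) := by
      by_contra! hcon
      have hle : N ≤ IsLocalRing.maximalIdeal R • N := by
        intro w hw
        obtain ⟨v, -, rfl⟩ := (Submodule.mem_smul_pointwise_iff_exists _ _ _).mp (hcon w hw)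
        refine Submodule.smul_mem_smul hm.1 ?_
        intro r hrp
        apply hx
        have := hw r hrp
        simp only [smul_zero]
        rw [smul_comm]
        exact this
      have hN := Submodule.eq_bot_of_le_smul_of_le_jacobson_bot _ N (IsNoetherian.noetherian N) hle
        (IsLocalRing.maximalIdeal_le_jacobson _)
      have : z ∈ N := fun r h => (hann r).mp h
      rw [hN] at this
      exact hz0 this
    let wb : QuotSMulTop x M := Submodule.Quotient.mk w
    have hwb : wb ≠ 0 := fun h => hw ((Submodule.Quotient.mk_eq_zero _).mp h)
    obtain ⟨q, hq, hle⟩ := exists_le_isAssociatedPrime_of_isNoetherianRing R wb hwb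
    obtain ⟨c, hc, hh⟩ := ih (QuotSMulTop x M) hm.2 hr q hq
    have hpq : p ≤ q := by
      intro r h
      apply hle
      rw [Submodule.mem_colon_singleton, Submodule.mem_bot, ← Submodule.Quotient.mk_smul,
        hwN r h, Submodule.Quotient.mk_zero]
    have hxq : x ∈ q := by
      apply hle
      rw [Submodule.mem_colon_singleton, Submodule.mem_bot, ← Submodule.Quotient.mk_smul,
        Submodule.Quotient.mk_eq_zero]
      exact Submodule.smul_mem_pointwise_smul _ _ _ trivial
    have hlt : (⟨p, hp.isPrime⟩ : PrimeSpectrum R) < c.head := by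
      rw [hh]
      exact lt_of_le_of_ne hpq (fun h => hxp (by
        have : p = q := congrArg PrimeSpectrum.asIdeal h
        rw [this]; exact hxq))
    exact ⟨c.cons _ hlt, by simp [hc], rfl⟩

open RingTheory.Sequence in
theorem aux_main (R : Type) [CommRing R] [IsNoetherianRing R] [IsLocalRing R]
    (a : Ideal R) (ha : a ≠ ⊤) (d : ℕ)
    (hd : ∀ c : LTSeries (PrimeSpectrum R), a ≤ c.head.asIdeal → c.length ≤ d) (k : ℕ) :
    ∀ (M : Type) [AddCommGroup M] [Module R M] [Module.Finite R M] [Nontrivial M]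
    (_ : ∃ rs : List R, rs.length = d + k ∧ (∀ r ∈ rs, r ∈ IsLocalRing.maximalIdeal R) ∧
      IsRegular M rs),
    ∃ rs : List R, rs.length = k ∧ (∀ r ∈ rs, r ∈ a) ∧ IsRegular M rs := by
  induction k with
  | zero =>
    intro M _ _ _ _ _
    exact ⟨[], rfl, by simp, IsRegular.nil R M⟩
  | succ k ih =>
    intro M _ _ _ _ h
    obtain ⟨y, hya, hy⟩ : ∃ y ∈ a, IsSMulRegular M y := by
      by_contra! hcon
      have hsub : (a : Set R) ⊆ ⋃ p ∈ associatedPrimes R M, (p : Set R) := by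
        rw [biUnion_associatedPrimes_eq_compl_regular]
        exact fun y hy => hcon y hy
      obtain ⟨p, hp, hap⟩ := (a.subset_union_prime_finite (associatedPrimes.finite R M)
        (f := id) 0 0 fun _ h _ _ ↦ h.1).1 hsub
      obtain ⟨rs, hl, hm, hr⟩ := h
      obtain ⟨c, hc, hh⟩ := aux_chain R rs M hm hr p hp
      have := hd c (by rw [hh]; exact hap)
      omega
    have hym := IsLocalRing.le_maximalIdeal ha hya
    have : Nontrivial (QuotSMulTop y M) :=
      nontrivial_quotSMulTop_of_mem_maximalIdeal M hym
    obtain ⟨rs, hl, hm, hr⟩ := ih (QuotSMulTop y M) (aux_depth_quot R M y hym hy (d + k) h)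
    exact ⟨y :: rs, by simp [hl], by simpa using ⟨hya, hm⟩, hr.cons hy⟩

theorem aux_bdd (R : Type) [CommRing R] [IsNoetherianRing R] [IsLocalRing R] :
    ∃ B : ℕ, ∀ c : LTSeries (PrimeSpectrum R), c.length ≤ B := by
  obtain ⟨B, hB⟩ : ∃ B : ℕ, ringKrullDim R = B := by
    have h1 := ringKrullDim_ne_top (R := R)
    have h2 := ringKrullDim_ne_bot (R := R)
    generalize ringKrullDim R = e at *
    induction e with
    | bot => exact absurd rfl h2
    | coe e =>
      induction e with
      | top => exact absurd rfl h1
      | coe e => exact ⟨e, rfl⟩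
  refine ⟨B, fun c => ?_⟩
  have := Order.LTSeries.length_le_krullDim c
  have h3 : Order.krullDim (PrimeSpectrum R) = B := hB
  rw [h3] at this
  exact_mod_cast this

open RingTheory.Sequence in
theorem aux_regbdd (R : Type) [CommRing R] [IsNoetherianRing R] [IsLocalRing R]
    (a : Ideal R) (ha : a ≠ ⊤) :
    BddAbove {d : ℤ | ∃ rs : List R, d = (rs.length : ℤ) ∧ (∀ r ∈ rs, r ∈ a) ∧
      RingTheory.Sequence.IsRegular R rs} := by
  obtain ⟨B, hB⟩ := aux_bdd R
  refine ⟨B, ?_⟩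
  rintro d ⟨rs, rfl, hm, hr⟩
  obtain ⟨p, hp⟩ := associatedPrimes.nonempty R R
  obtain ⟨c, hc, -⟩ := aux_chain R rs R (fun r h => IsLocalRing.le_maximalIdeal ha (hm r h)) hr p hp
  have := hB c
  omega

theorem aux_topDim (R : Type) [CommRing R] [IsNoetherianRing R] [IsLocalRing R]
    (a : Ideal R) (ha : a ≠ ⊤) (c : LTSeries (PrimeSpectrum R)) (hc : a ≤ c.head.asIdeal) :
    (c.length : ℤ) ≤ topDim (PrimeSpectrum (R ⧸ a)) := by
  have : Nontrivial (R ⧸ a) := Ideal.Quotient.nontrivial_iff.mpr ha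
  have : IsLocalRing (R ⧸ a) := IsLocalRing.of_surjective' _ Ideal.Quotient.mk_surjective
  let e := PrimeSpectrum.pointsEquivIrreducibleCloseds (R ⧸ a)
  obtain ⟨B, hB⟩ := aux_bdd (R ⧸ a)
  apply le_csSup
  · refine ⟨B, ?_⟩
    rintro d (rfl | ⟨n, rfl, f, hf⟩)
    · omega
    · have hs : StrictMono (fun i : Fin (n + 1) => e.symm (OrderDual.toDual (f i.rev))) := by
        intro i j hij
        have h1 : f j.rev < f i.rev := hf (Fin.rev_lt_rev.mpr hij)
        have h2 : OrderDual.toDual (f i.rev) < OrderDual.toDual (f j.rev) := h1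
        exact e.symm.strictMono h2
      have := hB (LTSeries.mk n _ hs)
      simpa using this
  · right
    refine ⟨c.length, rfl, ?_⟩
    have hci : ∀ i, a ≤ (c i).asIdeal := fun i => hc.trans (LTSeries.head_le c i)
    have hlt : ∀ p q : PrimeSpectrum R, p < q ↔ p.asIdeal < q.asIdeal := fun p q => Iff.rfl
    have hmap : ∀ i, ∃ q : PrimeSpectrum (R ⧸ a),
        PrimeSpectrum.comap (Ideal.Quotient.mk a) q = c i := by
      intro i
      have : c i ∈ Set.range (PrimeSpectrum.comap (Ideal.Quotient.mk a)) := by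
        rw [range_comap_of_surjective _ _ Ideal.Quotient.mk_surjective,
          Ideal.mk_ker]
        exact hci i
      exact this
    choose g hg using hmap
    have hgs : StrictMono g := by
      intro i j hij
      have h1 : c i < c j := c.strictMono hij
      rw [← hg i, ← hg j, hlt, lt_iff_le_not_ge] at h1
      have key : ∀ p q : PrimeSpectrum (R ⧸ a), (PrimeSpectrum.comap (Ideal.Quotient.mk a) p).asIdeal
          ≤ (PrimeSpectrum.comap (Ideal.Quotient.mk a) q).asIdeal ↔ p ≤ q := by
        intro p q
        simp only [PrimeSpectrum.comap_asIdeal]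
        rw [Ideal.comap_le_comap_iff_of_surjective _ Ideal.Quotient.mk_surjective]
        exact Iff.rfl
      rw [key, key] at h1
      exact lt_iff_le_not_ge.mpr h1
    refine ⟨fun i => OrderDual.ofDual (e (g i.rev)), fun i j hij => ?_⟩
    exact e.strictMono (hgs (Fin.rev_lt_rev.mpr hij))

/-- Let `(R, m)` be a noetherian local ring and `a ⊊ R` a proper ideal.
Then `dim R/a ≥ depth R − depth(a, R)`. -/
theorem stmt_17 (R : Type) [CommRing R] [IsNoetherianRing R] [IsLocalRing R]
    (a : Ideal R) (ha : a ≠ ⊤) :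
    topDim (PrimeSpectrum (R ⧸ a)) ≥
      idealDepth R (IsLocalRing.maximalIdeal R) R - idealDepth R a R := by
  have hmem : ∀ b : Ideal R, (0:ℤ) ∈ {d : ℤ | ∃ rs : List R, d = (rs.length : ℤ) ∧
      (∀ r ∈ rs, r ∈ b) ∧ RingTheory.Sequence.IsRegular R rs} := fun b =>
    ⟨[], rfl, by simp, RingTheory.Sequence.IsRegular.nil R R⟩
  have hD := aux_topDim R a ha (RelSeries.singleton _ ⟨IsLocalRing.maximalIdeal R, inferInstance⟩)
    (IsLocalRing.le_maximalIdeal ha)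
  have hbm := aux_regbdd R (IsLocalRing.maximalIdeal R) (Ideal.IsPrime.ne_top inferInstance)
  have hba := aux_regbdd R a ha
  have h0 : 0 ≤ idealDepth R a R := le_csSup hba (hmem a)
  obtain ⟨rs, hl, hm, hr⟩ := Int.csSup_mem ⟨0, hmem (IsLocalRing.maximalIdeal R)⟩ hbm
  change idealDepth R (IsLocalRing.maximalIdeal R) R = _ at hl
  simp only [RelSeries.singleton_length, Nat.cast_zero] at hD
  obtain ⟨d, hd⟩ := Int.eq_ofNat_of_zero_le hD
  by_cases hle : rs.length ≤ d
  · omega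
  · obtain ⟨k, hk⟩ := Nat.exists_eq_add_of_le (not_le.mp hle).le
    obtain ⟨ts, htl, htm, htr⟩ := aux_main R a ha d (fun c hc => by
      have := aux_topDim R a ha c hc
      omega) k R ⟨rs, hk, hm, hr⟩
    have : (ts.length : ℤ) ≤ idealDepth R a R := le_csSup hba ⟨ts, rfl, htm, htr⟩
    omega
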